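/- For every α ∈ (0, 1), ex(α) ≤ ex_T(α). -/

import Mathlib

open Filter MeasureTheory Pointwise

/-- `exZMod p λ α` is the minimum of `|A + λ·A|/p` over all `A ⊆ ℤ/pℤ` with `|A| ≥ αp`,
where `A + λ·A = {a + λa' : a, a' ∈ A}`. -/
noncomputable def exZMod (p : ℕ) (lam : ℤ) (α : ℝ) : ℝ :=
  sInf {x : ℝ | ∃ A : Finset (ZMod p), α * p ≤ (A.card : ℝ) ∧
    x = (((A + A.image fun a => (lam : ZMod p) * a).card : ℝ)) / p}

/-- `exLam λ α` is the limsup of `exZMod p λ α` over primes `p → ∞`. -/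
noncomputable def exLam (lam : ℤ) (α : ℝ) : ℝ :=
  Filter.limsup (fun p => exZMod p lam α) (Filter.atTop ⊓ Filter.principal {p : ℕ | p.Prime})

/-- `exD α` is the limsup of `exLam λ α` as `λ → ∞`. -/
noncomputable def exD (α : ℝ) : ℝ :=
  Filter.limsup (fun lam : ℤ => exLam lam α) Filter.atTop

abbrev 𝕋 : Type := AddCircle (1 : ℝ)

/-- Projection `𝕋^{n+1} → 𝕋^n` forgetting the first coordinate. -/
def projFirst (n : ℕ) (x : Fin (n + 1) → 𝕋) (i : Fin n) : 𝕋 := x i.succ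

/-- Projection `𝕋^{n+1} → 𝕋^n` forgetting the last coordinate. -/
def projLast (n : ℕ) (x : Fin (n + 1) → 𝕋) (i : Fin n) : 𝕋 := x i.castSucc

/-- Auxiliary: `exTdim m α` is the infimum of `μ(π₁(B) + π_{m+1}(B))` over open sets
`B ⊆ 𝕋^{m+1}` with `μ(B) > α`. -/
noncomputable def exTdim (m : ℕ) (α : ℝ) : ℝ :=
  sInf {x : ℝ | ∃ B : Set (Fin (m + 1) → 𝕋), IsOpen B ∧ α < (volume B).toReal ∧
    x = (volume (projFirst m '' B + projLast m '' B)).toReal}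

/-- `exT n α` is the paper's `ex_T(n, α)`, meaningful for `n ≥ 2`. -/
noncomputable def exT (n : ℕ) (α : ℝ) : ℝ := exTdim (n - 1) α

/-- `exT(α) = lim_{n→∞} ex_T(n, α)`; since `ex_T(n, α)` is non-increasing in `n` and
bounded below, this limit equals the infimum. -/
noncomputable def exTlim (α : ℝ) : ℝ := ⨅ n : ℕ, exT (n + 2) α

open Topology

/-- The point `(1, λ, …, λ^{n-1}) / p` of the torus. -/
noncomputable def torusPoint (n p : ℕ) (lam : ℤ) : Fin n → 𝕋 :=
  fun i => (((lam : ℝ) ^ (i : ℕ) / p : ℝ) : 𝕋)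

/-- The average of `f` over the cyclic group generated by `torusPoint n p lam`. -/
noncomputable def orbitAvg {n : ℕ} (f : (Fin n → 𝕋) → ℂ) (p : ℕ) (lam : ℤ) : ℂ :=
  (∑ j ∈ Finset.range p, f (j • torusPoint n p lam)) / p

instance isProbabilityMeasure_circle : IsProbabilityMeasure (volume : Measure 𝕋) :=
  ⟨by simp [AddCircle.measure_univ]⟩

lemma mFourier_add_apply {n : ℕ} (k : Fin n → ℤ) (x y : Fin n → 𝕋) :
    UnitAddTorus.mFourier k (x + y) = UnitAddTorus.mFourier k x * UnitAddTorus.mFourier k y := by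
  simp [UnitAddTorus.mFourier, Finset.prod_mul_distrib, fourier_apply, smul_add,
    AddCircle.toCircle_add]

lemma mFourier_zero_apply {n : ℕ} (k : Fin n → ℤ) :
    UnitAddTorus.mFourier k (0 : Fin n → 𝕋) = 1 := by
  simp [UnitAddTorus.mFourier]

lemma mFourier_nsmul_apply {n : ℕ} (k : Fin n → ℤ) (x : Fin n → 𝕋) (j : ℕ) :
    UnitAddTorus.mFourier k (j • x) = UnitAddTorus.mFourier k x ^ j := by
  induction j with
  | zero => simpa using mFourier_zero_apply k
  | succ j ih => rw [succ_nsmul, mFourier_add_apply, ih, pow_succ]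

lemma integral_mFourier_eq_zero {n : ℕ} {k : Fin n → ℤ} (hk : k ≠ 0) :
    ∫ x : Fin n → 𝕋, UnitAddTorus.mFourier k x = 0 := by
  obtain ⟨i, hi⟩ := Function.ne_iff.mp hk
  have hi' : k i ≠ 0 := hi
  let y : Fin n → 𝕋 := Pi.single i (((1 / 2 / (k i : ℝ) : ℝ)) : 𝕋)
  have hy : UnitAddTorus.mFourier k y = -1 := by
    have h : ∀ j, fourier (k j) (y j) = if j = i then (-1 : ℂ) else 1 := by
      intro j
      by_cases hj : j = i
      · subst hj
        have : (2 * Real.pi * Complex.I * k j * (1 / 2 / (k j : ℝ) : ℝ) / (1 : ℝ) : ℂ)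
            = Real.pi * Complex.I := by
          have : (k j : ℂ) ≠ 0 := by exact_mod_cast hi'
          push_cast
          field_simp
        simp only [y, Pi.single_eq_same, if_true]
        rw [fourier_coe_apply, this, Complex.exp_pi_mul_I]
      · simp [y, hj]
    rw [show UnitAddTorus.mFourier k y = ∏ j, fourier (k j) (y j) from rfl]
    simp only [h, Finset.prod_ite_eq', Finset.mem_univ, if_true]
  have h := integral_add_right_eq_self (μ := (volume : Measure (Fin n → 𝕋)))
    (fun x => UnitAddTorus.mFourier k x) y
  simp only [mFourier_add_apply, hy, mul_neg, mul_one, integral_neg] at h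
  exact self_eq_neg.mp h.symm

lemma nsmul_torusPoint (n p : ℕ) (hp : p ≠ 0) (lam : ℤ) : p • torusPoint n p lam = 0 := by
  ext i
  have hp' : (p : ℝ) ≠ 0 := by exact_mod_cast hp
  have : (p : ℝ) * ((lam : ℝ) ^ (i : ℕ) / p) = ((lam ^ (i : ℕ) : ℤ) : ℝ) := by
    push_cast
    field_simp
  simp only [torusPoint, Pi.smul_apply, Pi.zero_apply]
  rw [← AddCircle.coe_nsmul, nsmul_eq_mul, this, AddCircle.coe_eq_zero_iff]
  exact ⟨lam ^ (i : ℕ), by simp⟩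

lemma mFourier_torusPoint {n : ℕ} (k : Fin n → ℤ) (p : ℕ) (lam : ℤ) :
    UnitAddTorus.mFourier k (torusPoint n p lam) =
      (AddCircle.toCircle
        ((((∑ i, k i * lam ^ (i : ℕ) : ℤ) : ℝ) / p : ℝ) : 𝕋) : ℂ) := by
  have h : ((((∑ i, k i * lam ^ (i : ℕ) : ℤ) : ℝ) / p : ℝ) : 𝕋) =
      ∑ i, k i • torusPoint n p lam i := by
    push_cast
    rw [Finset.sum_div]
    rw [← QuotientAddGroup.mk'_apply, map_sum]
    refine Finset.sum_congr rfl fun i _ => ?_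
    rw [torusPoint, ← AddCircle.coe_zsmul, zsmul_eq_mul, mul_div_assoc]
    rfl
  rw [h]
  have h2 : ∀ s : Finset (Fin n), (AddCircle.toCircle (∑ i ∈ s, k i • torusPoint n p lam i) : ℂ) =
      ∏ i ∈ s, (fourier (k i) (torusPoint n p lam i) : ℂ) := by
    intro s
    induction s using Finset.induction_on with
    | empty => simp
    | insert a s ha ih =>
      rw [Finset.sum_insert ha, Finset.prod_insert ha, AddCircle.toCircle_add, Circle.coe_mul, ih,
        fourier_apply]
  rw [h2]
  rfl

lemma eventually_sum_mul_pow_ne_zero {n : ℕ} {k : Fin n → ℤ} (hk : k ≠ 0) :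
    ∀ᶠ lam : ℤ in atTop, ∑ i, k i * lam ^ (i : ℕ) ≠ 0 := by
  obtain ⟨i, hi⟩ := Function.ne_iff.mp hk
  let P : Polynomial ℤ := ∑ i, Polynomial.C (k i) * Polynomial.X ^ (i : ℕ)
  have hP : P ≠ 0 := by
    intro h
    apply hi
    have := congrArg (fun Q => Polynomial.coeff Q (i : ℕ)) h
    simpa [P, Polynomial.finsetSum_coeff, Polynomial.coeff_X_pow, Fin.val_inj] using this
  obtain ⟨b, hb⟩ := P.roots.toFinset.bddAbove
  filter_upwards [eventually_gt_atTop b] with lam hlam h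
  refine hlam.not_ge (hb ?_)
  rw [Finset.mem_coe, Multiset.mem_toFinset, Polynomial.mem_roots hP]
  simpa [P, Polynomial.IsRoot, Polynomial.eval_finsetSum] using h

lemma orbitAvg_mFourier_eq_zero {n : ℕ} {k : Fin n → ℤ} {p : ℕ} {lam : ℤ}
    (h0 : ∑ i, k i * lam ^ (i : ℕ) ≠ 0) (hp : (∑ i, k i * lam ^ (i : ℕ)).natAbs < p) :
    orbitAvg (UnitAddTorus.mFourier k) p lam = 0 := by
  have hp0 : p ≠ 0 := by omega
  have h1 : UnitAddTorus.mFourier k (torusPoint n p lam) ≠ 1 := by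
    rw [mFourier_torusPoint]
    set N := ∑ i, k i * lam ^ (i : ℕ)
    intro h
    have h' : AddCircle.toCircle ((((N : ℤ) : ℝ) / p : ℝ) : 𝕋) = AddCircle.toCircle (0 : 𝕋) := by
      rw [AddCircle.toCircle_zero]
      exact Circle.ext h
    have h'' := AddCircle.injective_toCircle one_ne_zero h'
    rw [AddCircle.coe_eq_zero_iff] at h''
    obtain ⟨m, hm⟩ := h''
    have hpr : (p : ℝ) ≠ 0 := by exact_mod_cast hp0
    have hN : (N : ℝ) = m * p := by
      rw [zsmul_eq_mul, mul_one] at hm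
      field_simp at hm
      linarith
    have hN' : N = m * p := by exact_mod_cast hN
    have hd : p ∣ N.natAbs := Int.natCast_dvd.mp ⟨m, by rw [hN', mul_comm]⟩
    exact absurd (Nat.le_of_dvd (Int.natAbs_pos.mpr h0) hd) (by omega)
  have h2 : UnitAddTorus.mFourier k (torusPoint n p lam) ^ p = 1 := by
    rw [← mFourier_nsmul_apply, nsmul_torusPoint n p hp0, mFourier_zero_apply]
  simp only [orbitAvg, mFourier_nsmul_apply]
  rw [geom_sum_eq h1, h2]
  simp

lemma orbitAvg_norm_sub_le {n : ℕ} (f g : C(Fin n → 𝕋, ℂ)) (p : ℕ) (lam : ℤ) :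
    ‖orbitAvg f p lam - orbitAvg g p lam‖ ≤ ‖f - g‖ := by
  rw [orbitAvg, orbitAvg, ← sub_div, ← Finset.sum_sub_distrib, norm_div, Complex.norm_natCast]
  refine div_le_of_le_mul₀ (by positivity) (by positivity) ?_
  refine (norm_sum_le_of_le _ (fun j _ => (f - g).norm_coe_le_norm (j • torusPoint n p lam))).trans
    ?_
  simp [mul_comm]

lemma integrable_continuousMap {n : ℕ} (f : C(Fin n → 𝕋, ℂ)) :
    Integrable (fun x => f x) (volume : Measure (Fin n → 𝕋)) :=
  f.continuous.integrable_of_hasCompactSupport (HasCompactSupport.of_compactSpace _)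

lemma integral_norm_sub_le {n : ℕ} (f g : C(Fin n → 𝕋, ℂ)) :
    ‖(∫ x, f x) - ∫ x, g x‖ ≤ ‖f - g‖ := by
  rw [← integral_sub (integrable_continuousMap f) (integrable_continuousMap g)]
  refine (norm_integral_le_of_norm_le_const (C := ‖f - g‖)
    (Eventually.of_forall fun x => (f - g).norm_coe_le_norm x)).trans ?_
  simp

lemma tendsto_orbitAvg_mFourier {n : ℕ} (k : Fin n → ℤ) :
    Tendsto (fun q : ℤ × ℕ => orbitAvg (UnitAddTorus.mFourier k) q.2 q.1)
      ((atTop : Filter ℤ).curry atTop) (𝓝 (∫ x, UnitAddTorus.mFourier k x)) := by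
  by_cases hk : k = 0
  · subst hk
    refine tendsto_const_nhds.congr' ?_
    refine eventually_curry_iff.mpr (Eventually.of_forall fun lam => ?_)
    filter_upwards [eventually_ne_atTop 0] with p hp
    have : (p : ℂ) ≠ 0 := by exact_mod_cast hp
    simp [orbitAvg, UnitAddTorus.mFourier_zero, this]
  · rw [integral_mFourier_eq_zero hk]
    refine tendsto_const_nhds.congr' ?_
    refine eventually_curry_iff.mpr ?_
    filter_upwards [eventually_sum_mul_pow_ne_zero hk] with lam h0
    filter_upwards [eventually_gt_atTop _] with p hp
    exact (orbitAvg_mFourier_eq_zero h0 hp).symm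

/-- As `p → ∞` and then `λ → ∞`, the points `j (1, λ, …, λ^{n-1}) / p` equidistribute. -/
theorem tendsto_orbitAvg {n : ℕ} (f : C(Fin n → 𝕋, ℂ)) :
    Tendsto (fun q : ℤ × ℕ => orbitAvg f q.2 q.1)
      ((atTop : Filter ℤ).curry atTop) (𝓝 (∫ x, f x)) := by
  have hspan : ∀ g ∈ Submodule.span ℂ (Set.range (UnitAddTorus.mFourier (d := Fin n))),
      Tendsto (fun q : ℤ × ℕ => orbitAvg g q.2 q.1)
        ((atTop : Filter ℤ).curry atTop) (𝓝 (∫ x, g x)) := by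
    intro g hg
    induction hg using Submodule.span_induction with
    | mem g hg =>
      obtain ⟨k, rfl⟩ := hg
      exact tendsto_orbitAvg_mFourier k
    | zero => simpa [orbitAvg] using tendsto_const_nhds
    | add g h _ _ hg hh =>
      have := hg.add hh
      rw [← integral_add (integrable_continuousMap g) (integrable_continuousMap h)] at this
      simpa [orbitAvg, Finset.sum_add_distrib, add_div] using this
    | smul c g _ hg =>
      have := hg.const_mul c
      rw [← integral_const_mul] at this
      simpa [orbitAvg, ← Finset.mul_sum, mul_div_assoc] using this
  have hf : f ∈ closure
      (Submodule.span ℂ (Set.range (UnitAddTorus.mFourier (d := Fin n))) : Set _) := by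
    rw [← Submodule.topologicalClosure_coe, UnitAddTorus.span_mFourier_closure_eq_top]
    trivial
  rw [Metric.tendsto_nhds]
  intro ε hε
  obtain ⟨g, hg, hfg⟩ := Metric.mem_closure_iff.mp hf (ε / 3) (by positivity)
  filter_upwards [Metric.tendsto_nhds.mp (hspan g hg) (ε / 3) (by positivity)] with q hq
  have h1 := orbitAvg_norm_sub_le f g q.2 q.1
  have h2 := integral_norm_sub_le g f
  have h3 := dist_triangle4 (orbitAvg f q.2 q.1) (orbitAvg g q.2 q.1) (∫ x, g x) (∫ x, f x)
  rw [← dist_eq_norm, ← dist_eq_norm] at h1 h2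
  linarith [dist_comm g f]

theorem tendsto_orbitAvg_real {n : ℕ} (f : C(Fin n → 𝕋, ℝ)) :
    Tendsto (fun q : ℤ × ℕ => (∑ j ∈ Finset.range q.2, f (j • torusPoint n q.2 q.1)) / q.2)
      ((atTop : Filter ℤ).curry atTop) (𝓝 (∫ x, f x)) := by
  have h := tendsto_orbitAvg (ContinuousMap.comp ⟨_, Complex.continuous_ofReal⟩ f)
  have h2 := (Complex.continuous_re.tendsto _).comp h
  simp only [ContinuousMap.comp_apply, ContinuousMap.coe_mk] at h2
  rw [integral_complex_ofReal, Complex.ofReal_re] at h2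
  refine h2.congr fun q => ?_
  simp only [Function.comp_apply, orbitAvg, ContinuousMap.comp_apply, ContinuousMap.coe_mk]
  norm_cast

/-- The homomorphism `x ↦ (x, λ x, …, λ^{n-1} x) / p` from `ℤ/pℤ` to the torus. -/
noncomputable def torusHom (n p : ℕ) [NeZero p] (lam : ℤ) (x : ZMod p) : Fin n → 𝕋 :=
  fun i => ZMod.toAddCircle ((lam : ZMod p) ^ (i : ℕ) * x)

lemma torusHom_natCast (n p : ℕ) [NeZero p] (lam : ℤ) (j : ℕ) :
    torusHom n p lam (j : ZMod p) = j • torusPoint n p lam := by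
  ext i
  have : (lam : ZMod p) ^ (i : ℕ) * j = ((lam ^ (i : ℕ) * j : ℤ) : ZMod p) := by push_cast; rfl
  rw [torusHom, this, ZMod.toAddCircle_intCast, Pi.smul_apply, torusPoint, ← AddCircle.coe_nsmul,
    nsmul_eq_mul]
  congr 1
  push_cast
  ring

lemma sum_torusHom {n p : ℕ} [NeZero p] (lam : ℤ) (f : (Fin n → 𝕋) → ℝ) :
    ∑ x : ZMod p, f (torusHom n p lam x) = ∑ j ∈ Finset.range p, f (j • torusPoint n p lam) := by
  symm
  refine Finset.sum_bij' (fun j _ => (j : ZMod p)) (fun x _ => x.val) (by simp) ?_ ?_ (by simp) ?_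
  · intro x _
    simpa using ZMod.val_lt x
  · intro j hj
    exact ZMod.val_cast_of_lt (Finset.mem_range.mp hj)
  · intro j _
    rw [torusHom_natCast]

lemma torusHom_add_mul {m p : ℕ} [NeZero p] (lam : ℤ) (a b : ZMod p) :
    torusHom m p lam (a + lam * b) =
      projFirst m (torusHom (m + 1) p lam b) + projLast m (torusHom (m + 1) p lam a) := by
  ext i
  simp only [torusHom, projFirst, projLast, Pi.add_apply, Fin.val_succ, Fin.val_castSucc,
    ← map_add]
  congr 1
  ring

lemma exZMod_nonneg (p : ℕ) (lam : ℤ) (α : ℝ) : 0 ≤ exZMod p lam α := by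
  refine Real.sInf_nonneg ?_
  rintro _ ⟨A, _, rfl⟩
  positivity

lemma exZMod_le {p : ℕ} {lam : ℤ} {α : ℝ} (A : Finset (ZMod p)) (hA : α * p ≤ (A.card : ℝ)) :
    exZMod p lam α ≤ (((A + A.image fun a => (lam : ZMod p) * a).card : ℝ)) / p := by
  refine csInf_le ⟨0, ?_⟩ ⟨A, hA, rfl⟩
  rintro _ ⟨A, _, rfl⟩
  positivity

instance neBot_atTop_primes : (atTop ⊓ 𝓟 {p : ℕ | p.Prime}).NeBot :=
  inf_principal_neBot_iff.mpr fun _ hU =>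
    (Nat.frequently_atTop_iff_infinite.mpr Nat.infinite_setOfPred_prime).and_eventually hU |>.exists.imp
      fun _ h => ⟨h.2, h.1⟩

lemma exLam_nonneg (lam : ℤ) {α : ℝ} (hα : α ≤ 1) : 0 ≤ exLam lam α := by
  refine le_limsup_of_frequently_le (Eventually.of_forall fun p => exZMod_nonneg p lam α).frequently
    ⟨1, ?_⟩
  rw [eventually_map]
  filter_upwards [mem_inf_of_right (mem_principal_self _)] with p hp
  have : Fact p.Prime := ⟨hp⟩
  have hp0 : (0 : ℝ) < p := by exact_mod_cast hp.pos
  refine (exZMod_le Finset.univ ?_).trans ?_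
  · simpa [ZMod.card] using mul_le_mul_of_nonneg_right hα hp0.le
  · rw [div_le_one hp0]
    have := Finset.card_le_univ
      (Finset.univ + Finset.univ.image fun a : ZMod p => (lam : ZMod p) * a)
    rw [ZMod.card] at this
    exact_mod_cast this

lemma exD_le_of_eventually {α c : ℝ} (hα : α ≤ 1)
    (h : ∀ᶠ lam : ℤ in atTop, ∀ᶠ p : ℕ in atTop, p.Prime → exZMod p lam α ≤ c) : exD α ≤ c := by
  refine limsup_le_of_le (isCoboundedUnder_le_of_le _ fun lam => exLam_nonneg lam hα) ?_
  filter_upwards [h] with lam hlam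
  refine limsup_le_of_le (isCoboundedUnder_le_of_le _ fun p => exZMod_nonneg p lam α) ?_
  exact eventually_inf_principal.mpr hlam

lemma continuous_projFirst (m : ℕ) : Continuous (projFirst m) :=
  continuous_pi fun i => continuous_apply i.succ

lemma continuous_projLast (m : ℕ) : Continuous (projLast m) :=
  continuous_pi fun i => continuous_apply i.castSucc

lemma isOpenMap_projFirst (m : ℕ) : IsOpenMap (projFirst m) := by
  refine IsOpenMap.of_sections fun x => ⟨fun y => Fin.cons (x 0) y, ?_, ?_, ?_⟩
  · exact (Continuous.finCons continuous_const continuous_id).continuousAt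
  · exact Fin.cons_self_tail x
  · intro y
    ext i
    simp [projFirst]

lemma exists_continuousMap_between {n : ℕ} {K U : Set (Fin n → 𝕋)} (hK : IsCompact K)
    (hU : IsOpen U) (hKU : K ⊆ U) :
    ∃ f : C(Fin n → 𝕋, ℝ), (∀ x, K.indicator 1 x ≤ f x) ∧ (∀ x, f x ≤ U.indicator 1 x) := by
  obtain ⟨f, h1, h0, -, h01⟩ := exists_continuous_one_zero_of_isCompact hK hU.isClosed_compl
    (Set.disjoint_compl_right_iff_subset.mpr hKU)
  refine ⟨f, fun x => ?_, fun x => ?_⟩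
  · refine Set.indicator_apply_le' (fun hx => (h1 hx).ge) fun _ => (h01 x).1
  · refine Set.le_indicator_apply (fun _ => (h01 x).2) fun hx => (h0 hx).le

lemma integrable_continuousMap_real {n : ℕ} (f : C(Fin n → 𝕋, ℝ)) :
    Integrable (fun x => f x) (volume : Measure (Fin n → 𝕋)) :=
  f.continuous.integrable_of_hasCompactSupport (HasCompactSupport.of_compactSpace _)

lemma exD_le_volume_sumset {m : ℕ} {α : ℝ} (hα₀ : 0 ≤ α) (hα : α ≤ 1) {B : Set (Fin (m + 1) → 𝕋)}
    (hB : IsOpen B) (hαB : α < (volume B).toReal) :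
    exD α ≤ (volume (projFirst m '' B + projLast m '' B)).toReal := by
  classical
  obtain ⟨K₀, hK₀B, hK₀, hαK₀⟩ := hB.exists_lt_isCompact
    ((ENNReal.ofReal_lt_iff_lt_toReal hα₀ (measure_ne_top _ _)).mpr hαB)
  obtain ⟨K, hK, hK₀K, hKB⟩ := exists_compact_between hK₀ hB hK₀B
  set S := projFirst m '' B + projLast m '' B with hS
  have hSo : IsOpen S := (isOpenMap_projFirst m B hB).add_right
  have hKS : projFirst m '' K + projLast m '' K ⊆ S :=
    Set.add_subset_add (Set.image_mono hKB) (Set.image_mono hKB)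
  obtain ⟨f, hf₀, hf₁⟩ := exists_continuousMap_between hK₀ isOpen_interior hK₀K
  obtain ⟨g, hg₀, hg₁⟩ := exists_continuousMap_between
    ((hK.image (continuous_projFirst m)).add (hK.image (continuous_projLast m))) hSo hKS
  have hf : α < ∫ x, f x := by
    refine ((ENNReal.ofReal_lt_iff_lt_toReal hα₀ (measure_ne_top _ _)).mp hαK₀).trans_le ?_
    rw [← Measure.real, ← integral_indicator_one hK₀.measurableSet]
    exact integral_mono ((integrable_const 1).indicator hK₀.measurableSet)
      (integrable_continuousMap_real f) hf₀
  have hg : ∫ x, g x ≤ (volume S).toReal := by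
    rw [← Measure.real, ← integral_indicator_one hSo.measurableSet]
    exact integral_mono (integrable_continuousMap_real g)
      ((integrable_const 1).indicator hSo.measurableSet) hg₁
  refine le_of_forall_pos_le_add fun ε hε => exD_le_of_eventually hα ?_
  have h1 := (tendsto_orbitAvg_real f).eventually (lt_mem_nhds hf)
  have h2 := (tendsto_orbitAvg_real g).eventually
    (gt_mem_nhds (show ∫ x, g x < (volume S).toReal + ε by linarith))
  filter_upwards [eventually_curry_iff.mp h1, eventually_curry_iff.mp h2] with lam h1 h2
  filter_upwards [h1, h2] with p h1 h2 hp
  have : Fact p.Prime := ⟨hp⟩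
  have hp0 : (0 : ℝ) < p := by exact_mod_cast hp.pos
  simp only [← sum_torusHom] at h1 h2
  let A : Finset (ZMod p) := Finset.univ.filter fun x => torusHom (m + 1) p lam x ∈ K
  refine (exZMod_le A ?_).trans ?_
  · rw [lt_div_iff₀ hp0] at h1
    refine h1.le.trans ?_
    rw [Finset.cast_card, Finset.sum_filter]
    refine Finset.sum_le_sum fun x _ => (hf₁ _).trans ?_
    rw [Set.indicator_apply]
    split_ifs with h h' h'
    · rfl
    · exact absurd (interior_subset h) h'
    · exact zero_le_one
    · rfl
  · refine le_trans (div_le_div_of_nonneg_right ?_ hp0.le) h2.le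
    have hsub : (A + A.image fun a => (lam : ZMod p) * a) ⊆ Finset.univ.filter fun y =>
        torusHom m p lam y ∈ projFirst m '' K + projLast m '' K := by
      intro y hy
      obtain ⟨a, ha, c, hc, rfl⟩ := Finset.mem_add.mp hy
      obtain ⟨b, hb, rfl⟩ := Finset.mem_image.mp hc
      rw [Finset.mem_filter]
      refine ⟨Finset.mem_univ _, ?_⟩
      rw [torusHom_add_mul]
      exact Set.add_mem_add ⟨_, (Finset.mem_filter.mp hb).2, rfl⟩
        ⟨_, (Finset.mem_filter.mp ha).2, rfl⟩
    refine (Nat.cast_le.mpr (Finset.card_le_card hsub)).trans ?_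
    rw [Finset.cast_card, Finset.sum_filter]
    refine Finset.sum_le_sum fun x _ => le_trans ?_ (hg₀ _)
    rw [Set.indicator_apply]
    rfl

/-- For every `α ∈ (0, 1)`, `ex(α) ≤ ex_T(α)`. -/
theorem exD_le_exTlim :
    ∀ α : ℝ, 0 < α → α < 1 → exD α ≤ exTlim α := by
  intro α hα₀ hα
  refine le_ciInf fun n => le_csInf ?_ ?_
  · exact ⟨_, Set.univ, isOpen_univ, by simpa using hα, rfl⟩
  · rintro _ ⟨B, hB, hαB, rfl⟩
    exact exD_le_volume_sumset hα₀.le hα.le hB hαB
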